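/- Let f : {-1,1}^n → {-1,1} and g : {-1,1}^n → [-1,1] with E[f(x)] = E[g(x)] = 0, and suppose g is d-resilient for some d ≥ 0. Define recursively f₀ = f, g₀ = g, and f_k = f∘f_{k−1}, g_k = g∘g_{k−1} (disjoint composition) for k ≥ 1. Then for every k ≥ 1: (1) f_k and g_k are functions on n^{k+1} variables; (2) g_k is ((d+1)^{k+1} − 1)-resilient; and (3) dist(f_k, g_k) ≤ dist(f,g)·Σ_{t=0}^{k} Inf[f]^t. -/

import Mathlib

open Finset

noncomputable section

/-- The value `±1` of a bit, with `true ↦ 1` and `false ↦ -1`. -/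
def sgn (b : Bool) : ℝ := if b then 1 else -1

/-- Expectation of `f` over a uniformly random point of the hypercube `{-1,1}^ι`. -/
def expect {ι : Type*} [Fintype ι] [DecidableEq ι] (f : (ι → Bool) → ℝ) : ℝ :=
  (∑ x : ι → Bool, f x) / 2 ^ (Fintype.card ι)

/-- Fourier coefficient `ĝ(S) = E[g(x) ∏_{i ∈ S} x_i]`. -/
def fcoef {ι : Type*} [Fintype ι] [DecidableEq ι] (g : (ι → Bool) → ℝ) (S : Finset ι) : ℝ :=
  expect (fun x => g x * ∏ i ∈ S, sgn (x i))

/-- `g` is `d`-resilient if all its Fourier coefficients of degree at most `d` vanish. -/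
def Resilient {ι : Type*} [Fintype ι] [DecidableEq ι] (d : ℕ) (g : (ι → Bool) → ℝ) : Prop :=
  ∀ S : Finset ι, S.card ≤ d → fcoef g S = 0

/-- `f` is Boolean-valued (takes values in `{-1,1}`). -/
def IsBooleanValued {ι : Type*} (f : (ι → Bool) → ℝ) : Prop := ∀ x, f x = 1 ∨ f x = -1

/-- `g` is bounded (takes values in `[-1,1]`). -/
def IsBounded {ι : Type*} (g : (ι → Bool) → ℝ) : Prop := ∀ x, |g x| ≤ 1

/-- `f` is `α`-approximately `d`-resilient: `f` is `α`-close in `ℓ₁` to a bounded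
`d`-resilient function. -/
def ApproxResilient {ι : Type*} [Fintype ι] [DecidableEq ι] (α : ℝ) (d : ℕ)
    (f : (ι → Bool) → ℝ) : Prop :=
  ∃ g : (ι → Bool) → ℝ, Resilient d g ∧ IsBounded g ∧ expect (fun x => |f x - g x|) ≤ α

/-- The multilinear (Fourier) extension of `G : {-1,1}^κ → ℝ` to `[-1,1]^κ`, evaluated at `t`:
`G̃(t) = E[G(b(t₁),…,b(tₘ))]` where `b(tᵢ)` are independent `±1` bits with `E[b(tᵢ)] = tᵢ`. -/
def mExt {κ : Type*} [Fintype κ] [DecidableEq κ] (G : (κ → Bool) → ℝ) (t : κ → ℝ) : ℝ :=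
  ∑ y : κ → Bool, G y * ∏ i, (if y i then (1 + t i) / 2 else (1 - t i) / 2)

/-- Disjoint composition `G ∘ g` of `G : {-1,1}^κ → [-1,1]` with `g : {-1,1}^ι → [-1,1]`:
`(G∘g)(x) = G̃(g(x¹),…,g(xᵐ))`, a function on `{-1,1}^{κ × ι}`. -/
def Comp {κ ι : Type*} [Fintype κ] [DecidableEq κ] [Fintype ι] [DecidableEq ι]
    (G : (κ → Bool) → ℝ) (g : (ι → Bool) → ℝ) : (κ × ι → Bool) → ℝ :=
  fun x => mExt G (fun i => g (fun j => x (i, j)))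

/-- `dist(u,v) = (1/2)·E_x[|u(x) − v(x)|]`. -/
def hdist {ι : Type*} [Fintype ι] [DecidableEq ι] (u v : (ι → Bool) → ℝ) : ℝ :=
  expect (fun x => |u x - v x|) / 2

/-- Noise sensitivity `NS_δ[F] = Pr[F(y) ≠ F(z)]` where `y` is uniform and `z` flips each
coordinate of `y` independently with probability `δ`. -/
def NS {κ : Type*} [Fintype κ] [DecidableEq κ] (δ : ℝ) (F : (κ → Bool) → ℝ) : ℝ :=
  (∑ y : κ → Bool, ∑ z : κ → Bool,
      (∏ i, if z i = y i then 1 - δ else δ) * (if F y = F z then 0 else 1)) /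
    2 ^ (Fintype.card κ)

/-- Total influence `Inf[f] = Σᵢ Pr_x[f(x) ≠ f(x^{⊕i})]`. -/
def totalInfluence {ι : Type*} [Fintype ι] [DecidableEq ι] (f : (ι → Bool) → ℝ) : ℝ :=
  ∑ i : ι, expect (fun x => if f x = f (Function.update x i (!x i)) then 0 else 1)

/-- Index type for the `k`-fold iterated disjoint composition of functions on `{-1,1}^n`:
`It n 0 = Fin n`, `It n (k+1) = Fin n × It n k`. -/
def It (n : ℕ) : ℕ → Type
  | 0 => Fin n
  | k + 1 => Fin n × It n k

instance ItFintype (n : ℕ) : ∀ k, Fintype (It n k)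
  | 0 => inferInstanceAs (Fintype (Fin n))
  | k + 1 =>
    letI := ItFintype n k
    inferInstanceAs (Fintype (Fin n × It n k))

instance ItDecEq (n : ℕ) : ∀ k, DecidableEq (It n k)
  | 0 => inferInstanceAs (DecidableEq (Fin n))
  | k + 1 =>
    letI := ItDecEq n k
    inferInstanceAs (DecidableEq (Fin n × It n k))

/-- The iterated disjoint composition `f₀ = f`, `f_k = f ∘ f_{k-1}`. -/
def iterComp (n : ℕ) (f : (Fin n → Bool) → ℝ) : ∀ k, (It n k → Bool) → ℝ
  | 0 => f
  | k + 1 => Comp f (iterComp n f k)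

section CubeExpectation

variable {ι κ : Type*} [Fintype ι] [DecidableEq ι] [Fintype κ] [DecidableEq κ]

theorem cube_expect_sum {α : Type*} (s : Finset α) (F : α → (ι → Bool) → ℝ) :
    expect (fun x => ∑ a ∈ s, F a x) = ∑ a ∈ s, expect (F a) := by
  unfold _root_.expect
  rw [Finset.sum_comm, Finset.sum_div]

theorem cube_expect_add (u v : (ι → Bool) → ℝ) :
    expect (fun x => u x + v x) = expect u + expect v := by
  unfold _root_.expect
  rw [Finset.sum_add_distrib, add_div]

theorem cube_expect_const_mul (c : ℝ) (u : (ι → Bool) → ℝ) :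
    expect (fun x => c * u x) = c * expect u := by
  unfold _root_.expect
  rw [← Finset.mul_sum, mul_div_assoc]

theorem cube_expect_const (c : ℝ) : expect (fun _ : ι → Bool => c) = c := by
  simp [_root_.expect]

theorem cube_expect_mono {u v : (ι → Bool) → ℝ} (h : ∀ x, u x ≤ v x) :
    expect u ≤ expect v := by
  unfold _root_.expect
  gcongr with x
  exact h x

theorem cube_expect_nonneg {u : (ι → Bool) → ℝ} (h : ∀ x, 0 ≤ u x) : 0 ≤ expect u := by
  simpa [cube_expect_const] using cube_expect_mono (u := fun _ => 0) h

/-- Functions of disjoint blocks of variables are independent. -/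
theorem cube_expect_prod_blocks (φ : κ → (ι → Bool) → ℝ) :
    expect (fun x : κ × ι → Bool => ∏ i, φ i (fun j => x (i, j))) = ∏ i, expect (φ i) := by
  have h : ∑ x : κ × ι → Bool, ∏ i, φ i (fun j => x (i, j)) =
      ∏ i, ∑ z : ι → Bool, φ i z := by
    rw [Finset.prod_univ_sum, Fintype.piFinset_univ]
    exact (Equiv.curry κ ι Bool).sum_comp (fun p => ∏ i, φ i (p i))
  unfold _root_.expect
  rw [h, Finset.prod_div_distrib, Finset.prod_const, Fintype.card_prod, mul_comm, pow_mul,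
    Finset.card_univ]

theorem hdist_nonneg (u v : (ι → Bool) → ℝ) : 0 ≤ hdist u v :=
  div_nonneg (cube_expect_nonneg fun _ => abs_nonneg _) zero_le_two

theorem hdist_triangle (u v w : (ι → Bool) → ℝ) : hdist u w ≤ hdist u v + hdist v w := by
  unfold hdist
  rw [← add_div, ← cube_expect_add]
  gcongr
  exact cube_expect_mono fun x => abs_sub_le _ _ _

theorem hdist_self (u : (ι → Bool) → ℝ) : hdist u u = 0 := by
  simp [hdist, cube_expect_const]

theorem totalInfluence_nonneg (f : (ι → Bool) → ℝ) : 0 ≤ totalInfluence f :=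
  Finset.sum_nonneg fun _ _ => cube_expect_nonneg fun _ => by split_ifs <;> norm_num

end CubeExpectation

section BitWeight

/-- The probability that a random `±1` bit of mean `t` takes the value `b`. -/
def bitWeight (b : Bool) (t : ℝ) : ℝ := if b then (1 + t) / 2 else (1 - t) / 2

theorem bitWeight_eq (b : Bool) (t : ℝ) : bitWeight b t = (1 + sgn b * t) / 2 := by
  cases b <;> simp [bitWeight, sgn, sub_eq_add_neg]

theorem bitWeight_nonneg (b : Bool) {t : ℝ} (ht : |t| ≤ 1) : 0 ≤ bitWeight b t := by
  have := abs_le.1 ht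
  cases b <;> simp [bitWeight] <;> linarith

theorem abs_sgn (b : Bool) : |sgn b| = 1 := by cases b <;> simp [sgn]

theorem sgn_not (b : Bool) : sgn (!b) = -sgn b := by cases b <;> simp [sgn]

theorem expect_bitWeight {ι : Type*} [Fintype ι] [DecidableEq ι] (b : Bool)
    {u : (ι → Bool) → ℝ} (hu : expect u = 0) : expect (fun x => bitWeight b (u x)) = 1 / 2 := by
  have h : (fun x => bitWeight b (u x)) = fun x => 1 / 2 + sgn b / 2 * u x := by
    funext x
    rw [bitWeight_eq]
    ring
  rw [h, cube_expect_add, cube_expect_const_mul, cube_expect_const, hu, mul_zero, add_zero]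

end BitWeight

section MultilinearExtension

variable {ι κ : Type*} [Fintype ι] [DecidableEq ι] [Fintype κ] [DecidableEq κ]

theorem mExt_eq_sum (G : (κ → Bool) → ℝ) (t : κ → ℝ) :
    mExt G t = ∑ y : κ → Bool, G y * ∏ i, bitWeight (y i) (t i) := rfl

theorem mExt_sub (F G : (κ → Bool) → ℝ) (t : κ → ℝ) :
    mExt (fun y => F y - G y) t = mExt F t - mExt G t := by
  simp only [mExt_eq_sum, sub_mul, Finset.sum_sub_distrib]

theorem mExt_one (t : κ → ℝ) : mExt (fun _ => 1) t = 1 := by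
  have h := Finset.prod_univ_sum (fun _ : κ => (Finset.univ : Finset Bool))
    (fun i b => bitWeight b (t i))
  rw [Fintype.piFinset_univ] at h
  simp only [mExt_eq_sum, one_mul, ← h]
  refine Finset.prod_eq_one fun i _ => ?_
  simp [bitWeight]
  ring

theorem mExt_mono {F G : (κ → Bool) → ℝ} {t : κ → ℝ} (ht : ∀ i, |t i| ≤ 1)
    (h : ∀ y, F y ≤ G y) : mExt F t ≤ mExt G t :=
  Finset.sum_le_sum fun y _ => mul_le_mul_of_nonneg_right (h y)
    (Finset.prod_nonneg fun i _ => bitWeight_nonneg (y i) (ht i))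

theorem abs_mExt_le (G : (κ → Bool) → ℝ) {t : κ → ℝ} (ht : ∀ i, |t i| ≤ 1) :
    |mExt G t| ≤ mExt (fun y => |G y|) t := by
  simp only [mExt_eq_sum]
  refine (Finset.abs_sum_le_sum_abs _ _).trans (Finset.sum_le_sum fun y _ => ?_)
  rw [abs_mul, abs_of_nonneg (Finset.prod_nonneg fun i _ => bitWeight_nonneg (y i) (ht i))]

theorem sum_comp_flip (i : κ) (F : (κ → Bool) → ℝ) :
    ∑ y, F (Function.update y i (!y i)) = ∑ y, F y := by
  have h : Function.Involutive fun y : κ → Bool => Function.update y i (!y i) := by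
    intro y
    simp
  exact Equiv.sum_comp h.toPerm F

/-- Changing one argument of the multilinear extension. -/
theorem abs_mExt_sub_update_le (f : (κ → Bool) → ℝ) {c : κ → ℝ} (hc : ∀ j, |c j| ≤ 1) (i : κ)
    (b : ℝ) :
    |mExt f c - mExt f (Function.update c i b)| ≤
      ∑ y, |f y - f (Function.update y i (!y i))| / 2 *
        ∏ j, if j = i then |c i - b| / 2 else bitWeight (y j) (c j) := by
  set P : (κ → Bool) → ℝ := fun y => ∏ j ∈ Finset.univ.erase i, bitWeight (y j) (c j) with hP
  set F : (κ → Bool) → ℝ := fun y => sgn (y i) * ((c i - b) / 2) * P y with hF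
  have hPpos : ∀ y, 0 ≤ P y := fun y =>
    Finset.prod_nonneg fun j _ => bitWeight_nonneg (y j) (hc j)
  have hPflip : ∀ y, P (Function.update y i (!y i)) = P y := fun y =>
    Finset.prod_congr rfl fun j hj => by
      rw [Function.update_of_ne (Finset.ne_of_mem_erase hj)]
  have hdiff : mExt f c - mExt f (Function.update c i b) = ∑ y, f y * F y := by
    simp only [mExt_eq_sum, ← Finset.sum_sub_distrib]
    refine Finset.sum_congr rfl fun y _ => ?_
    have hupd : ∏ j ∈ Finset.univ.erase i, bitWeight (y j) (Function.update c i b j) = P y :=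
      Finset.prod_congr rfl fun j hj => by
        rw [Function.update_of_ne (Finset.ne_of_mem_erase hj)]
    rw [← Finset.mul_prod_erase _ (fun j => bitWeight (y j) (c j)) (Finset.mem_univ i),
      ← Finset.mul_prod_erase _ (fun j => bitWeight (y j) (Function.update c i b j))
        (Finset.mem_univ i), hupd, Function.update_self, bitWeight_eq, bitWeight_eq]
    simp only [hF, hP]
    ring
  have hFflip : ∀ y, F (Function.update y i (!y i)) = -F y := fun y => by
    simp only [hF, hPflip, Function.update_self, sgn_not]
    ring
  have hsymm : ∑ y, f y * F y =
      ∑ y, (f y - f (Function.update y i (!y i))) / 2 * F y := by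
    have h := sum_comp_flip i fun y => f y * F y
    simp only [hFflip] at h
    have h' : ∑ y, (f y - f (Function.update y i (!y i))) / 2 * F y =
        (∑ y, f y * F y + ∑ y, f (Function.update y i (!y i)) * -F y) / 2 := by
      rw [← Finset.sum_add_distrib, Finset.sum_div]
      exact Finset.sum_congr rfl fun y _ => by ring
    rw [h', h]
    ring
  rw [hdiff, hsymm]
  refine (Finset.abs_sum_le_sum_abs _ _).trans (Finset.sum_le_sum fun y _ => le_of_eq ?_)
  rw [← Finset.mul_prod_erase _ _ (Finset.mem_univ i), if_pos rfl,
    Finset.prod_congr rfl fun j hj => if_neg (Finset.ne_of_mem_erase hj)]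
  simp only [hF]
  rw [abs_mul, abs_mul, abs_mul, abs_sgn, abs_of_nonneg (hPpos y), abs_div, abs_div,
    abs_two, one_mul]

end MultilinearExtension

section Composition

variable {ι κ : Type*} [Fintype ι] [DecidableEq ι] [Fintype κ] [DecidableEq κ]

theorem IsBooleanValued.isBounded {α : Type*} {f : (α → Bool) → ℝ} (hf : IsBooleanValued f) :
    IsBounded f := fun x => by
  rcases hf x with h | h <;> simp [h]

theorem IsBounded.comp {G : (κ → Bool) → ℝ} {g : (ι → Bool) → ℝ} (hG : IsBounded G)
    (hg : IsBounded g) : IsBounded (Comp G g) := fun _ => by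
  refine (abs_mExt_le G fun _ => hg _).trans ?_
  exact (mExt_mono (fun _ => hg _) hG).trans_eq (mExt_one _)

/-- A tuple of independent bits with balanced means is uniformly distributed. -/
theorem expect_mExt_blocks (G : (κ → Bool) → ℝ) {u : κ → (ι → Bool) → ℝ}
    (hu : ∀ i, expect (u i) = 0) :
    expect (fun x : κ × ι → Bool => mExt G fun i => u i fun j => x (i, j)) = expect G := by
  simp only [mExt_eq_sum]
  rw [cube_expect_sum]
  simp only [cube_expect_const_mul]
  have h : ∀ y : κ → Bool, expect (fun x : κ × ι → Bool =>
      ∏ i, bitWeight (y i) (u i fun j => x (i, j))) = (1 / 2) ^ Fintype.card κ := fun y => by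
    rw [cube_expect_prod_blocks fun i z => bitWeight (y i) (u i z),
      Finset.prod_congr rfl fun i _ => expect_bitWeight (y i) (hu i), Finset.prod_const,
      Finset.card_univ]
  simp only [h]
  rw [← Finset.sum_mul, _root_.expect, one_div, inv_pow, div_eq_mul_inv]

theorem expect_Comp (G : (κ → Bool) → ℝ) {g : (ι → Bool) → ℝ} (hg : expect g = 0) :
    expect (Comp G g) = expect G :=
  expect_mExt_blocks G fun _ => hg

theorem hdist_Comp_left_le (F G : (κ → Bool) → ℝ) {g : (ι → Bool) → ℝ} (hg : IsBounded g)
    (hE : expect g = 0) : hdist (Comp F g) (Comp G g) ≤ hdist F G := by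
  unfold hdist
  rw [← expect_Comp (fun y => |F y - G y|) hE]
  gcongr
  refine cube_expect_mono fun x => ?_
  simp only [Comp, ← mExt_sub]
  exact abs_mExt_le _ fun _ => hg _

theorem expect_abs_sub_flip {f : (κ → Bool) → ℝ} (hf : IsBooleanValued f) (i : κ) :
    expect (fun y => |f y - f (Function.update y i (!y i))|) =
      2 * expect (fun y => if f y = f (Function.update y i (!y i)) then 0 else 1) := by
  rw [← cube_expect_const_mul]
  congr 1
  funext y
  rcases hf y with h | h <;> rcases hf (Function.update y i (!y i)) with h' | h' <;>
    rw [h, h'] <;> norm_num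

/-- Replacing the inner function of one block costs at most the influence of that block. -/
theorem hdist_mExt_blocks_update_le {f : (κ → Bool) → ℝ} (hf : IsBooleanValued f)
    {u : κ → (ι → Bool) → ℝ} (hu : ∀ j, IsBounded (u j)) (hE : ∀ j, expect (u j) = 0) (i : κ)
    (v : (ι → Bool) → ℝ) :
    hdist (fun x : κ × ι → Bool => mExt f fun j => u j fun l => x (j, l))
        (fun x => mExt f fun j => Function.update u i v j fun l => x (j, l)) ≤
      expect (fun y => if f y = f (Function.update y i (!y i)) then 0 else 1) *
        hdist (u i) v := by
  set D : (κ → Bool) → ℝ := fun y => |f y - f (Function.update y i (!y i))| with hD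
  have hpt : ∀ x : κ × ι → Bool,
      |mExt f (fun j => u j fun l => x (j, l)) -
        mExt f (fun j => Function.update u i v j fun l => x (j, l))| ≤
      ∑ y, D y / 2 * ∏ j, (fun z => if j = i then |u i z - v z| / 2
        else bitWeight (y j) (u j z)) (fun l => x (j, l)) := fun x => by
    have hupd : (fun j => Function.update u i v j fun l => x (j, l)) =
        Function.update (fun j => u j fun l => x (j, l)) i (v fun l => x (i, l)) := by
      funext j
      by_cases hj : j = i
      · subst hj
        simp
      · simp [hj]
    rw [hupd]
    refine (abs_mExt_sub_update_le f (fun j => hu j _) i _).trans_eq ?_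
    refine Finset.sum_congr rfl fun y _ => ?_
    congr 1
    refine Finset.prod_congr rfl fun j _ => ?_
    by_cases hj : j = i
    · subst hj
      simp
    · simp [hj]
  have hprod : ∀ y : κ → Bool, expect (fun x : κ × ι → Bool =>
      ∏ j, (fun z => if j = i then |u i z - v z| / 2
        else bitWeight (y j) (u j z)) (fun l => x (j, l))) =
      hdist (u i) v * (2 * (1 / 2) ^ Fintype.card κ) := fun y => by
    rw [cube_expect_prod_blocks fun j z => if j = i then |u i z - v z| / 2
        else bitWeight (y j) (u j z), ← Finset.mul_prod_erase _ _ (Finset.mem_univ i)]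
    have herase : ∀ j ∈ Finset.univ.erase i, expect (fun z => if j = i then |u i z - v z| / 2
        else bitWeight (y j) (u j z)) = 1 / 2 := fun j hj => by
      simp only [if_neg (Finset.ne_of_mem_erase hj)]
      exact expect_bitWeight (y j) (hE j)
    rw [Finset.prod_congr rfl herase, Finset.prod_const,
      Finset.card_erase_of_mem (Finset.mem_univ i), Finset.card_univ]
    have hhalf : expect (fun z => if i = i then |u i z - v z| / 2
        else bitWeight (y i) (u i z)) = hdist (u i) v := by
      simp only [if_true, hdist, _root_.expect, ← Finset.sum_div]
      ring
    obtain ⟨m, hm⟩ := Nat.exists_eq_succ_of_ne_zero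
      (Fintype.card_pos_iff.2 ⟨i⟩).ne'
    rw [hhalf, hm, Nat.succ_sub_one, pow_succ]
    ring
  have hle := cube_expect_mono hpt
  rw [cube_expect_sum] at hle
  simp only [cube_expect_const_mul] at hle
  simp only [hprod] at hle
  rw [← Finset.sum_mul, ← Finset.sum_div] at hle
  have hI := expect_abs_sub_flip hf i
  have hsum : (∑ y, D y) / 2 * (hdist (u i) v * (2 * (1 / 2) ^ Fintype.card κ)) =
      expect D * hdist (u i) v := by
    rw [_root_.expect, one_div, inv_pow, div_eq_mul_inv (∑ y, D y) (2 ^ _)]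
    ring
  rw [hsum, hD, hI] at hle
  rw [hdist, div_le_iff₀ two_pos]
  linarith

theorem hdist_Comp_right_le {f : (κ → Bool) → ℝ} (hf : IsBooleanValued f)
    {u v : (ι → Bool) → ℝ} (hu : IsBounded u) (hv : IsBounded v) (hEu : expect u = 0)
    (hEv : expect v = 0) : hdist (Comp f u) (Comp f v) ≤ totalInfluence f * hdist u v := by
  have key : ∀ s : Finset κ,
      hdist (Comp f u) (fun x : κ × ι → Bool =>
        mExt f fun j => (if j ∈ s then v else u) fun l => x (j, l)) ≤
      (∑ i ∈ s, expect (fun y => if f y = f (Function.update y i (!y i)) then 0 else 1)) *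
        hdist u v := by
    intro s
    induction s using Finset.induction_on with
    | empty =>
      simp only [Finset.notMem_empty, if_false, Finset.sum_empty, zero_mul]
      exact (hdist_self (Comp f u)).le
    | insert i s hi ih =>
      have hstep := hdist_mExt_blocks_update_le (u := fun j => if j ∈ s then v else u) hf
        (fun j => by split_ifs <;> assumption)
        (fun j => by split_ifs <;> assumption) i v
      have hupd : Function.update (fun j => if j ∈ s then v else u) i v =
          fun j => if j ∈ insert i s then v else u := by
        funext j
        by_cases hj : j = i
        · subst hj
          simp
        · simp [hj]
      rw [hupd] at hstep
      simp only [if_neg hi] at hstep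
      rw [Finset.sum_insert hi, add_mul, add_comm]
      exact (hdist_triangle _ _ _).trans (add_le_add ih hstep)
  have h := key Finset.univ
  simp only [Finset.mem_univ, if_true] at h
  exact h

theorem Resilient.comp {a b : ℕ} {G : (κ → Bool) → ℝ} {g : (ι → Bool) → ℝ}
    (hG : Resilient a G) (hg : Resilient b g) :
    Resilient ((a + 1) * (b + 1) - 1) (Comp G g) := by
  intro S hS
  set B : κ → Finset ι := fun i => Finset.univ.filter fun j => (i, j) ∈ S with hB
  have hchar : ∀ x : κ × ι → Bool,
      ∏ p ∈ S, sgn (x p) = ∏ i, ∏ j ∈ B i, sgn (x (i, j)) := fun x => by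
    simp only [hB, Finset.prod_filter]
    rw [← Fintype.prod_prod_type' (fun i j => if (i, j) ∈ S then sgn (x (i, j)) else 1)]
    simp
  have hcard : S.card = ∑ i, (B i).card := by
    simp only [hB, Finset.card_filter]
    rw [← Fintype.sum_prod_type' (fun i j => if (i, j) ∈ S then 1 else 0)]
    simp
  set p : κ → ℝ := fun i => expect (fun z => ∏ j ∈ B i, sgn (z j)) / 2 with hp
  set q : κ → ℝ := fun i => fcoef g (B i) / 2 with hq
  have hcoef : fcoef (Comp G g) S = ∑ y, G y * ∏ i, (sgn (y i) * q i + p i) := by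
    have hexp : (fun x => Comp G g x * ∏ r ∈ S, sgn (x r)) = fun x => ∑ y, G y *
        ∏ i, (fun z => bitWeight (y i) (g z) * ∏ j ∈ B i, sgn (z j)) (fun j => x (i, j)) := by
      funext x
      rw [hchar, Comp, mExt_eq_sum, Finset.sum_mul]
      simp only [Finset.prod_mul_distrib, mul_assoc]
    rw [fcoef, hexp, cube_expect_sum]
    refine Finset.sum_congr rfl fun y _ => ?_
    rw [cube_expect_const_mul,
      cube_expect_prod_blocks fun i z => bitWeight (y i) (g z) * ∏ j ∈ B i, sgn (z j)]
    congr 1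
    refine Finset.prod_congr rfl fun i _ => ?_
    have hblock : (fun z => bitWeight (y i) (g z) * ∏ j ∈ B i, sgn (z j)) = fun z =>
        sgn (y i) / 2 * (g z * ∏ j ∈ B i, sgn (z j)) + 1 / 2 * ∏ j ∈ B i, sgn (z j) := by
      funext z
      rw [bitWeight_eq]
      ring
    rw [hblock, cube_expect_add, cube_expect_const_mul, cube_expect_const_mul]
    simp only [hq, hp, fcoef]
    ring
  rw [hcoef]
  simp only [Finset.prod_add, Finset.mul_sum]
  rw [Finset.sum_comm]
  refine Finset.sum_eq_zero fun T _ => ?_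
  have hT : (∑ y, G y * ∏ i ∈ T, sgn (y i)) * ∏ i ∈ T, q i = 0 := by
    by_cases hTa : T.card ≤ a
    · have h := hG T hTa
      rw [fcoef, _root_.expect, div_eq_zero_iff] at h
      rw [h.resolve_right (by positivity), zero_mul]
    · have hex : ∃ i ∈ T, (B i).card ≤ b := by
        by_contra! hcon
        have h1 : T.card * (b + 1) ≤ ∑ i ∈ T, (B i).card := by
          simpa using Finset.card_nsmul_le_sum T _ (b + 1) fun i hi => hcon i hi
        have h2 : ∑ i ∈ T, (B i).card ≤ ∑ i, (B i).card :=
          Finset.sum_le_sum_of_subset (Finset.subset_univ T)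
        have h3 : (a + 1) * (b + 1) ≤ T.card * (b + 1) :=
          Nat.mul_le_mul_right _ (by omega)
        have h4 : 0 < (a + 1) * (b + 1) := by positivity
        omega
      obtain ⟨i, hi, hib⟩ := hex
      rw [Finset.prod_eq_zero hi (by simp [hq, hg _ hib]), mul_zero]
  calc ∑ y, G y * ((∏ i ∈ T, sgn (y i) * q i) * ∏ i ∈ Finset.univ \ T, p i)
      = (∑ y, G y * ∏ i ∈ T, sgn (y i)) * (∏ i ∈ T, q i) * ∏ i ∈ Finset.univ \ T, p i := by
        simp only [Finset.sum_mul, Finset.prod_mul_distrib, mul_assoc]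
    _ = 0 := by rw [hT, zero_mul]

end Composition

section Iteration

variable {n : ℕ}

theorem card_It (n k : ℕ) : Fintype.card (It n k) = n ^ (k + 1) := by
  induction k with
  | zero => exact (Fintype.card_fin n).trans (pow_one n).symm
  | succ k ih =>
    have h : Fintype.card (It n (k + 1)) = Fintype.card (Fin n) * Fintype.card (It n k) :=
      Fintype.card_prod _ _
    rw [h, ih, Fintype.card_fin, pow_succ' n (k + 1)]

theorem IsBounded.iterComp {f : (Fin n → Bool) → ℝ} (hf : IsBounded f) :
    ∀ k, IsBounded (iterComp n f k)
  | 0 => hf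
  | k + 1 => hf.comp (IsBounded.iterComp hf k)

theorem expect_iterComp {f : (Fin n → Bool) → ℝ} (hf : expect f = 0) :
    ∀ k, expect (iterComp n f k) = 0
  | 0 => hf
  | k + 1 => (expect_Comp f (expect_iterComp hf k)).trans hf

theorem Resilient.iterComp {d : ℕ} {g : (Fin n → Bool) → ℝ} (hg : Resilient d g) (k : ℕ) :
    Resilient ((d + 1) ^ (k + 1) - 1) (iterComp n g k) := by
  induction k with
  | zero =>
    rw [zero_add, pow_one, Nat.add_sub_cancel]
    exact hg
  | succ k ih =>
    have h := hg.comp ih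
    rw [Nat.sub_add_cancel (Nat.one_le_pow _ _ d.succ_pos), ← pow_succ'] at h
    exact h

theorem hdist_iterComp_le {f g : (Fin n → Bool) → ℝ} (hf : IsBooleanValued f)
    (hg : IsBounded g) (hEf : expect f = 0) (hEg : expect g = 0) (k : ℕ) :
    hdist (iterComp n f k) (iterComp n g k) ≤
      hdist f g * ∑ t ∈ Finset.range (k + 1), totalInfluence f ^ t := by
  induction k with
  | zero =>
    rw [zero_add, Finset.sum_range_one, pow_zero, mul_one]
    exact le_refl (hdist f g)
  | succ k ih =>
    have hright := hdist_Comp_right_le hf (hf.isBounded.iterComp k) (hg.iterComp k)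
      (expect_iterComp hEf k) (expect_iterComp hEg k)
    have hleft := hdist_Comp_left_le f g (hg.iterComp k) (expect_iterComp hEg k)
    calc hdist (iterComp n f (k + 1)) (iterComp n g (k + 1))
        ≤ hdist (Comp f (iterComp n f k)) (Comp f (iterComp n g k)) +
          hdist (Comp f (iterComp n g k)) (Comp g (iterComp n g k)) := hdist_triangle _ _ _
      _ ≤ totalInfluence f *
            (hdist f g * ∑ t ∈ Finset.range (k + 1), totalInfluence f ^ t) + hdist f g :=
          add_le_add
            (hright.trans (mul_le_mul_of_nonneg_left ih (totalInfluence_nonneg f))) hleft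
      _ = hdist f g * ∑ t ∈ Finset.range (k + 2), totalInfluence f ^ t := by
          rw [geom_sum_succ (n := k + 1)]
          ring

end Iteration

/-- **Resilience amplification.** Let `f : {-1,1}^n → {-1,1}` and `g : {-1,1}^n → [-1,1]` with
`E[f] = E[g] = 0`, and suppose `g` is `d`-resilient.  Define `f₀ = f`, `g₀ = g`,
`f_k = f∘f_{k-1}`, `g_k = g∘g_{k-1}`.  Then for every `k ≥ 1`: (1) `f_k` and `g_k` are
functions on `n^{k+1}` variables; (2) `g_k` is `((d+1)^{k+1} − 1)`-resilient; and
(3) `dist(f_k, g_k) ≤ dist(f,g)·Σ_{t=0}^{k} Inf[f]^t`. -/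
theorem stmt12 (n d : ℕ) (f g : (Fin n → Bool) → ℝ)
    (hf : IsBooleanValued f) (hg : IsBounded g)
    (hEf : expect f = 0) (hEg : expect g = 0)
    (hgr : Resilient d g)
    (k : ℕ) (hk : 1 ≤ k) :
    Fintype.card (It n k) = n ^ (k + 1) ∧
    Resilient ((d + 1) ^ (k + 1) - 1) (iterComp n g k) ∧
    hdist (iterComp n f k) (iterComp n g k) ≤
      hdist f g * ∑ t ∈ Finset.range (k + 1), totalInfluence f ^ t := by
  exact ⟨card_It n k, hgr.iterComp k, hdist_iterComp_le hf hg hEf hEg k⟩
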